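/- Let a,b be positive integers with a+b even and let p be a prime with p \ge a+b+2. Writing H(-)=H(-;p-1) and S(-)=S(-;p-1), one has S(a,-b) \equiv H(a,-b) \equiv -S(-b,a) \equiv -H(-b,a) \equiv \sum_{k=0}^{p-a-1} \binom{p-a}{k} \frac{2(1-2^{2p-a-b-k}) B_k B_{2p-a-b-k}}{(p-a)(2p-a-b-k)} \pmod{p}. -/

import Mathlib

open Finset

/-- sign of an integer as a rational: `-1` if negative, else `1`. -/
def sgn (s : ℤ) : ℚ := if s < 0 then -1 else 1

/-- Auxiliary: alternating multiple harmonic sum with the index list reversed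
    (head of the list corresponds to the outermost, i.e. largest, summation index). -/
def Hrev : List ℤ → ℕ → ℚ
  | [], _ => 1
  | s :: t, n => ∑ k ∈ Finset.Icc 1 n, (sgn s) ^ k / (k : ℚ) ^ s.natAbs * Hrev t (k - 1)

/-- The alternating multiple harmonic sum `H(s₁,…,s_d; n)`:
    the sum over `1 ≤ k₁ < ⋯ < k_d ≤ n` of `∏ sign(sᵢ)^{kᵢ}/kᵢ^{|sᵢ|}`. -/
def H (s : List ℤ) (n : ℕ) : ℚ := Hrev s.reverse n

/-- Auxiliary for the non-strict version. -/
def Srev : List ℤ → ℕ → ℚ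
  | [], _ => 1
  | s :: t, n => ∑ k ∈ Finset.Icc 1 n, (sgn s) ^ k / (k : ℚ) ^ s.natAbs * Srev t k

/-- The non-strict alternating multiple harmonic sum `S(s₁,…,s_d; n)`:
    the sum over `1 ≤ k₁ ≤ ⋯ ≤ k_d ≤ n`. -/
def S (s : List ℤ) (n : ℕ) : ℚ := Srev s.reverse n

/-- `x ≡ y (mod m)` for rationals: the numerator of `x - y` in lowest terms is
    divisible by `m`. -/
def pcong (m : ℕ) (x y : ℚ) : Prop := (m : ℤ) ∣ (x - y).num

/-- The Fermat quotient of 2 : `q_p = (2^{p-1}-1)/p`. -/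
def qp (p : ℕ) : ℚ := (2 ^ (p - 1) - 1) / p

/-- `s ⊕ t = sign(st)(|s|+|t|)`, with the convention that `0 ⊕ t = t` and `s ⊕ 0 = s`. -/
def oplus (s t : ℤ) : ℤ :=
  if s = 0 then t else if t = 0 then s else (s * t).sign * (|s| + |t|)

section Localization

variable (p : ℕ) [Fact p.Prime]

/-- The subring of `p`-integral rational numbers. -/
def pIntegers : Subring ℚ where
  carrier := {x | padicNorm p x ≤ 1}
  mul_mem' {x y} hx hy := by
    simpa [padicNorm.mul] using mul_le_one₀ hx (padicNorm.nonneg y) hy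
  one_mem' := by simp
  add_mem' hx hy := padicNorm.nonarchimedean.trans (max_le hx hy)
  zero_mem' := by simp
  neg_mem' hx := by simpa using hx

/-- The maximal ideal of the `p`-integral rational numbers, as an additive subgroup of `ℚ`. -/
def pMultiples : AddSubgroup ℚ where
  carrier := {x | padicNorm p x < 1}
  add_mem' hx hy := padicNorm.nonarchimedean.trans_lt (max_lt hx hy)
  zero_mem' := by simp
  neg_mem' hx := by simpa using hx

variable {p}

theorem mem_pIntegers {x : ℚ} : x ∈ pIntegers p ↔ padicNorm p x ≤ 1 := Iff.rfl

theorem mem_pMultiples {x : ℚ} : x ∈ pMultiples p ↔ padicNorm p x < 1 := Iff.rfl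

theorem mul_mem_pMultiples {x y : ℚ} (hx : x ∈ pIntegers p) (hy : y ∈ pMultiples p) :
    x * y ∈ pMultiples p := by
  rw [mem_pMultiples, padicNorm.mul]
  exact mul_lt_one_of_nonneg_of_lt_one_right hx (padicNorm.nonneg y) hy

theorem inv_mem_pIntegers {k : ℕ} (h : ¬ p ∣ k) : (k : ℚ)⁻¹ ∈ pIntegers p := by
  rw [mem_pIntegers, ← one_div, padicNorm.div, (padicNorm.nat_eq_one_iff k).2 h]
  simp

theorem inv_mem_pIntegers_of_lt {k : ℕ} (hk : 0 < k) (hkp : k < p) :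
    (k : ℚ)⁻¹ ∈ pIntegers p :=
  inv_mem_pIntegers (Nat.not_dvd_of_pos_of_lt hk hkp)

theorem intCast_mem_pMultiples {z : ℤ} (h : (p : ℤ) ∣ z) : (z : ℚ) ∈ pMultiples p :=
  (padicNorm.int_lt_one_iff z).2 h

theorem natCast_self_mem_pMultiples : (p : ℚ) ∈ pMultiples p := by
  exact_mod_cast intCast_mem_pMultiples (dvd_refl (p : ℤ))

theorem pow_sub_pow_mem_pMultiples {x y : ℚ} (hx : x ∈ pIntegers p) (hy : y ∈ pIntegers p)
    (h : x - y ∈ pMultiples p) (m : ℕ) : x ^ m - y ^ m ∈ pMultiples p := by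
  rw [← (Commute.all x y).geom_sum₂_mul m]
  exact mul_mem_pMultiples
    (sum_mem fun i _ => mul_mem (pow_mem hx _) (pow_mem hy _)) h

theorem pcong_iff {x y : ℚ} : pcong p x y ↔ x - y ∈ pMultiples p := by
  rw [pcong, ← padicNorm.int_lt_one_iff, mem_pMultiples]
  set z := x - y
  have hz : padicNorm p (z.num : ℚ) = padicNorm p z * padicNorm p (z.den : ℚ) := by
    rw [← padicNorm.mul, Rat.mul_den_eq_num]
  constructor
  · intro h
    by_cases hd : p ∣ z.den
    · have hn : p ∣ z.num.natAbs :=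
        Int.natCast_dvd.1 ((padicNorm.int_lt_one_iff _).1 h)
      have := Nat.dvd_gcd hn hd
      rw [z.reduced] at this
      exact absurd this (Fact.out : p.Prime).not_dvd_one
    · rwa [hz, (padicNorm.nat_eq_one_iff _).2 hd, mul_one] at h
  · intro h
    rw [hz]
    exact mul_lt_one_of_nonneg_of_lt_one_left (padicNorm.nonneg _) h (padicNorm.of_nat _)

theorem bernoulli_mem_pIntegers {n : ℕ} (hn : n + 1 < p) : bernoulli n ∈ pIntegers p := by
  suffices h : bernoulli' n ∈ pIntegers p by
    rw [bernoulli]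
    exact mul_mem (pow_mem (neg_mem (one_mem _)) n) h
  induction n using Nat.strong_induction_on with
  | _ n ih =>
    rw [bernoulli'_def]
    refine sub_mem (one_mem _) (sum_mem fun k hk => ?_)
    have hk := mem_range.1 hk
    refine mul_mem ?_ (ih k hk (by omega))
    have : ((n : ℚ) - k + 1) = ((n - k + 1 : ℕ) : ℚ) := by
      push_cast [Nat.cast_sub hk.le]; ring
    rw [this, div_eq_mul_inv]
    exact mul_mem (natCast_mem _ _) (inv_mem_pIntegers_of_lt (by omega) (by omega))

theorem one_div_pow_sub_pow_mem_pMultiples {k : ℕ} (hk : 0 < k) (hkp : k < p) {a m n : ℕ}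
    (h : m + (p - 1) = n + a) :
    (k : ℚ) ^ n - (k : ℚ) ^ m / (k : ℚ) ^ a ∈ pMultiples p := by
  have hk0 : (k : ℚ) ≠ 0 := by positivity
  have hfermat : ((k : ℤ) ^ (p - 1) - 1 : ℤ) ≡ 0 [ZMOD p] := by
    have := Int.ModEq.pow_card_sub_one_eq_one (Fact.out : p.Prime) (n := k)
      (Nat.isCoprime_iff_coprime.2 (Nat.coprime_of_lt_prime hk.ne' hkp (Fact.out : p.Prime)).symm)
    simpa using this.sub_right 1
  have hmem := intCast_mem_pMultiples (Int.modEq_zero_iff_dvd.1 hfermat)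
  push_cast at hmem
  have : (k : ℚ) ^ n - (k : ℚ) ^ m / (k : ℚ) ^ a
      = (k : ℚ) ^ m * ((k : ℚ)⁻¹) ^ a * ((k : ℚ) ^ (p - 1) - 1) := by
    have e : (k : ℚ) ^ m * (k : ℚ) ^ (p - 1) = (k : ℚ) ^ n * (k : ℚ) ^ a := by
      rw [← pow_add, ← pow_add, h]
    rw [inv_pow]
    field_simp
    linear_combination -e
  rw [this]
  exact mul_mem_pMultiples (mul_mem (pow_mem (natCast_mem _ _) _)
    (pow_mem (inv_mem_pIntegers_of_lt hk hkp) _)) hmem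

theorem sum_mem_pMultiples_of_reflect (hp2 : p ≠ 2) (f : ℕ → ℚ)
    (hf : ∀ k, 0 < k → k < p → f k + f (p - k) ∈ pMultiples p) :
    ∑ k ∈ Icc 1 (p - 1), f k ∈ pMultiples p := by
  have hp := (Fact.out : p.Prime).two_le
  have hrefl : ∑ k ∈ Icc 1 (p - 1), f (p - k) = ∑ k ∈ Icc 1 (p - 1), f k := by
    refine sum_nbij' (p - ·) (p - ·) ?_ ?_ ?_ ?_ fun _ _ => rfl <;>
      simp only [mem_Icc] <;> omega
  have h2 : ∑ k ∈ Icc 1 (p - 1), f k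
      = ((2 : ℕ) : ℚ)⁻¹ * ∑ k ∈ Icc 1 (p - 1), (f k + f (p - k)) := by
    rw [sum_add_distrib, hrefl]
    push_cast
    ring
  rw [h2]
  refine mul_mem_pMultiples (inv_mem_pIntegers_of_lt two_pos (by omega)) (sum_mem fun k hk => ?_)
  rw [mem_Icc] at hk
  exact hf k (by omega) (by omega)

theorem inv_pow_reflect_mem_pMultiples {k : ℕ} (hk : 0 < k) (hkp : k < p) (m : ℕ) :
    (((p - k : ℕ) : ℚ)⁻¹) ^ m - (-(k : ℚ)⁻¹) ^ m ∈ pMultiples p := by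
  have hk' := inv_mem_pIntegers_of_lt hk hkp
  have hpk := inv_mem_pIntegers_of_lt (p := p) (k := p - k) (by omega) (by omega)
  refine pow_sub_pow_mem_pMultiples hpk (neg_mem hk') ?_ m
  have h1 : (k : ℚ) ≠ 0 := by positivity
  have h2 : ((p - k : ℕ) : ℚ) ≠ 0 := by
    have : 0 < p - k := by omega
    positivity
  have h3 : ((p - k : ℕ) : ℚ) + k = p := by
    rw [← Nat.cast_add]; congr 1; omega
  have : ((p - k : ℕ) : ℚ)⁻¹ - -(k : ℚ)⁻¹ = ((p - k : ℕ) : ℚ)⁻¹ * (k : ℚ)⁻¹ * p := by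
    rw [← h3]; field_simp; ring
  rw [this]
  exact mul_mem_pMultiples (mul_mem hpk hk') natCast_self_mem_pMultiples

theorem sum_one_div_pow_mem_pMultiples (hp2 : p ≠ 2) {a : ℕ} (ha : Odd a) :
    ∑ k ∈ Icc 1 (p - 1), 1 / (k : ℚ) ^ a ∈ pMultiples p := by
  refine sum_mem_pMultiples_of_reflect hp2 _ fun k hk hkp => ?_
  have h := inv_pow_reflect_mem_pMultiples hk hkp a
  rw [ha.neg_pow] at h
  convert h using 1
  simp only [inv_pow, one_div]
  ring

theorem sum_alternating_div_pow_mem_pMultiples (hp2 : p ≠ 2) {b : ℕ} (hb : Even b) :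
    ∑ k ∈ Icc 1 (p - 1), (-1) ^ k / (k : ℚ) ^ b ∈ pMultiples p := by
  refine sum_mem_pMultiples_of_reflect hp2 _ fun k hk hkp => ?_
  have h := inv_pow_reflect_mem_pMultiples hk hkp b
  rw [hb.neg_pow] at h
  have hodd : Odd p := (Fact.out : p.Prime).odd_of_ne_two hp2
  have hs : (-1 : ℚ) ^ (p - k) = -(-1) ^ k := by
    have h1 : (-1 : ℚ) ^ (p - k) * (-1) ^ k = -1 := by
      rw [← pow_add, Nat.sub_add_cancel hkp.le, hodd.neg_one_pow]
    rcases neg_one_pow_eq_or ℚ k with h2 | h2 <;> rw [h2] at h1 ⊢ <;> linarith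
  have : (-1 : ℚ) ^ k / (k : ℚ) ^ b + (-1) ^ (p - k) / ((p - k : ℕ) : ℚ) ^ b
      = -(-1) ^ k * ((((p - k : ℕ) : ℚ)⁻¹) ^ b - ((k : ℚ)⁻¹) ^ b) := by
    rw [hs, inv_pow, inv_pow]
    ring
  rw [this]
  exact mul_mem_pMultiples (neg_mem (pow_mem (neg_mem (one_mem _)) _)) h

end Localization

section AlternatingPowerSum

open PowerSeries in
theorem bernoulliPowerSeries_sub_rescale_two_mul_exp_add_one :
    (bernoulliPowerSeries ℚ - rescale 2 (bernoulliPowerSeries ℚ)) * (exp ℚ + 1) = X := by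
  have h1 := bernoulliPowerSeries_mul_exp_sub_one ℚ
  have h2 := congrArg (rescale (2 : ℚ)) h1
  have he : rescale (2 : ℚ) (exp ℚ) = exp ℚ ^ 2 := by
    simpa using (exp_pow_eq_rescale_exp (A := ℚ) 2).symm
  rw [map_mul, map_sub, map_one, rescale_X, he] at h2
  have hC : (C (2 : ℚ) : PowerSeries ℚ) = 2 := map_ofNat C 2
  rw [hC] at h2
  have hne : exp ℚ - 1 ≠ 0 := by
    rintro h
    rw [h, mul_zero] at h1
    exact X_ne_zero h1.symm
  refine mul_right_cancel₀ hne ?_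
  linear_combination (exp ℚ + 1) * h1 - h2

open PowerSeries in
theorem sum_choose_mul_one_sub_two_pow_mul_bernoulli (n : ℕ) :
    ∑ i ∈ range (n + 1), (n.choose i : ℚ) * ((1 - 2 ^ i) * bernoulli i)
      + (1 - 2 ^ n) * bernoulli n = if n = 1 then 1 else 0 := by
  have h := congrArg (coeff n) bernoulliPowerSeries_sub_rescale_two_mul_exp_add_one
  rw [mul_add, mul_one, map_add, coeff_mul, coeff_X,
    Nat.sum_antidiagonal_eq_sum_range_succ_mk] at h
  simp only [map_sub, coeff_rescale, bernoulliPowerSeries, coeff_mk, coeff_exp] at h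
  have hn : (n.factorial : ℚ) ≠ 0 := by exact_mod_cast n.factorial_ne_zero
  have h' := congrArg (fun x => (n.factorial : ℚ) * x) h
  simp only [mul_add, mul_sum] at h'
  convert h' using 1
  · congr 1
    · refine sum_congr rfl fun i hi => ?_
      have hi : i ≤ n := Nat.lt_succ_iff.1 (mem_range.1 hi)
      rw [Nat.cast_choose ℚ hi]
      simp only [eq_ratCast, Rat.cast_id]
      field_simp
    · simp only [eq_ratCast, Rat.cast_id]
      field_simp
  · split_ifs with h1 <;> simp [h1]

/-- The value at `0` of the Euler polynomial of degree `n`. -/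
def eulerZero (n : ℕ) : ℚ := 2 * (1 - 2 ^ (n + 1)) * bernoulli (n + 1) / (n + 1 : ℕ)

theorem sum_choose_mul_eulerZero (n : ℕ) :
    ∑ i ∈ range (n + 1), (n.choose i : ℚ) * eulerZero i + eulerZero n = 2 * 0 ^ n := by
  have h := sum_choose_mul_one_sub_two_pow_mul_bernoulli (n + 1)
  rw [sum_range_succ'] at h
  have hn : ((n + 1 : ℕ) : ℚ) ≠ 0 := by positivity
  have key : ∀ i, ((n + 1).choose (i + 1) : ℚ) * ((1 - 2 ^ (i + 1)) * bernoulli (i + 1))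
      = (n + 1 : ℕ) / 2 * ((n.choose i : ℚ) * eulerZero i) := by
    intro i
    have hc : ((n + 1 : ℕ) : ℚ) * n.choose i = (n + 1).choose (i + 1) * (i + 1 : ℕ) := by
      exact_mod_cast Nat.add_one_mul_choose_eq n i
    have hi : ((i + 1 : ℕ) : ℚ) ≠ 0 := by positivity
    rw [eulerZero]
    field_simp
    linear_combination -(1 - 2 ^ (i + 1)) * bernoulli (i + 1) * hc
  have key' : (1 - 2 ^ (n + 1)) * bernoulli (n + 1) = (n + 1 : ℕ) / 2 * eulerZero n := by
    simpa using key n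
  simp only [key, key', ← mul_sum] at h
  have h0 : (if n + 1 = 1 then (1 : ℚ) else 0) = (n + 1 : ℕ) / 2 * (2 * 0 ^ n) := by
    rcases n with _ | n <;> simp
  rw [h0] at h
  refine mul_left_cancel₀ (div_ne_zero hn two_ne_zero) ?_
  rw [← h]
  simp
  ring

theorem sum_choose_mul_alternating_sum_pow {p : ℕ} (hp : Odd p) (n : ℕ) :
    ∑ i ∈ range (n + 1), (n.choose i : ℚ) * ∑ k ∈ range p, (-1) ^ k * (k : ℚ) ^ i
      + ∑ k ∈ range p, (-1) ^ k * (k : ℚ) ^ n = p ^ n + 0 ^ n := by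
  have hbinom : ∑ i ∈ range (n + 1), (n.choose i : ℚ) * ∑ k ∈ range p, (-1) ^ k * (k : ℚ) ^ i
      = ∑ k ∈ range p, (-1) ^ k * ((k + 1 : ℕ) : ℚ) ^ n := by
    simp only [mul_sum]
    rw [sum_comm]
    refine sum_congr rfl fun k _ => ?_
    rw [Nat.cast_add, Nat.cast_one, add_pow, mul_sum]
    refine sum_congr rfl fun i _ => ?_
    simp
    ring
  rw [hbinom, ← sum_add_distrib]
  have htel := sum_range_sub' (fun k : ℕ => (-1 : ℚ) ^ k * (k : ℚ) ^ n) p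
  rw [hp.neg_one_pow] at htel
  simp only [pow_zero, Nat.cast_zero] at htel
  calc _ = ∑ k ∈ range p, ((-1 : ℚ) ^ k * (k : ℚ) ^ n
        - (-1) ^ (k + 1) * ((k + 1 : ℕ) : ℚ) ^ n) := sum_congr rfl fun k _ => by ring
    _ = _ := by rw [htel]; ring

theorem alternating_sum_pow_sub_eulerZero_mem_pMultiples {p : ℕ} [Fact p.Prime] (hp2 : p ≠ 2)
    (n : ℕ) :
    ∑ k ∈ range p, (-1) ^ k * (k : ℚ) ^ n - eulerZero n ∈ pMultiples p := by
  have hp := (Fact.out : p.Prime).two_le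
  induction n using Nat.strong_induction_on with
  | _ n ih =>
    have h1 := sum_choose_mul_alternating_sum_pow ((Fact.out : p.Prime).odd_of_ne_two hp2) n
    have h2 := sum_choose_mul_eulerZero n
    rw [sum_range_succ] at h1 h2
    simp only [Nat.choose_self, Nat.cast_one, one_mul] at h1 h2
    have hpow : (p : ℚ) ^ n - 0 ^ n ∈ pMultiples p :=
      pow_sub_pow_mem_pMultiples (natCast_mem _ p) (zero_mem _)
        (by simpa using natCast_self_mem_pMultiples) n
    have hsum : ∑ i ∈ range n, (n.choose i : ℚ) *
        (∑ k ∈ range p, (-1) ^ k * (k : ℚ) ^ i - eulerZero i) ∈ pMultiples p :=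
      sum_mem fun i hi => mul_mem_pMultiples (natCast_mem _ _) (ih i (mem_range.1 hi))
    have h : ∑ k ∈ range p, (-1) ^ k * (k : ℚ) ^ n - eulerZero n
        = ((2 : ℕ) : ℚ)⁻¹ * ((p : ℚ) ^ n - 0 ^ n - ∑ i ∈ range n, (n.choose i : ℚ) *
          (∑ k ∈ range p, (-1) ^ k * (k : ℚ) ^ i - eulerZero i)) := by
      simp only [mul_sub, sum_sub_distrib]
      push_cast
      linear_combination (h1 - h2) / 2
    rw [h]
    exact mul_mem_pMultiples (inv_mem_pIntegers_of_lt two_pos (by omega)) (sub_mem hpow hsum)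

end AlternatingPowerSum

section DoubleSums

theorem sum_mul_sum_Icc_sub (f g : ℕ → ℚ) (n : ℕ) :
    ∑ k ∈ Icc 1 n, f k * ∑ j ∈ Icc 1 k, g j - ∑ k ∈ Icc 1 n, f k * ∑ j ∈ Icc 1 (k - 1), g j
      = ∑ k ∈ Icc 1 n, f k * g k := by
  rw [← sum_sub_distrib]
  refine sum_congr rfl fun k hk => ?_
  obtain ⟨m, rfl⟩ := Nat.exists_eq_add_of_le' (mem_Icc.1 hk).1
  rw [sum_Icc_succ_top (by omega), Nat.add_sub_cancel]
  ring

theorem sum_mul_sum_Icc_add (f g : ℕ → ℚ) (n : ℕ) :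
    ∑ k ∈ Icc 1 n, f k * ∑ j ∈ Icc 1 (k - 1), g j + ∑ k ∈ Icc 1 n, g k * ∑ j ∈ Icc 1 k, f j
      = (∑ k ∈ Icc 1 n, f k) * ∑ k ∈ Icc 1 n, g k := by
  induction n with
  | zero => simp
  | succ n ih =>
    simp only [sum_Icc_succ_top (Nat.le_add_left 1 n), Nat.add_sub_cancel]
    linear_combination ih

theorem sgn_natCast (a : ℕ) : sgn a = 1 := if_neg (by omega)

theorem sgn_neg_natCast {b : ℕ} (hb : 0 < b) : sgn (-(b : ℤ)) = -1 := if_pos (by omega)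

variable (a : ℕ) {b : ℕ} (n : ℕ)

theorem H_pos_neg (hb : 0 < b) : H [(a : ℤ), -(b : ℤ)] n
    = ∑ k ∈ Icc 1 n, (-1) ^ k / (k : ℚ) ^ b * ∑ j ∈ Icc 1 (k - 1), 1 / (j : ℚ) ^ a := by
  simp [H, Hrev, sgn_natCast, sgn_neg_natCast hb]

theorem H_neg_pos (hb : 0 < b) : H [-(b : ℤ), (a : ℤ)] n
    = ∑ k ∈ Icc 1 n, 1 / (k : ℚ) ^ a * ∑ j ∈ Icc 1 (k - 1), (-1) ^ j / (j : ℚ) ^ b := by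
  simp [H, Hrev, sgn_natCast, sgn_neg_natCast hb]

theorem S_pos_neg (hb : 0 < b) : S [(a : ℤ), -(b : ℤ)] n
    = ∑ k ∈ Icc 1 n, (-1) ^ k / (k : ℚ) ^ b * ∑ j ∈ Icc 1 k, 1 / (j : ℚ) ^ a := by
  simp [S, Srev, sgn_natCast, sgn_neg_natCast hb]

theorem S_neg_pos (hb : 0 < b) : S [-(b : ℤ), (a : ℤ)] n
    = ∑ k ∈ Icc 1 n, 1 / (k : ℚ) ^ a * ∑ j ∈ Icc 1 k, (-1) ^ j / (j : ℚ) ^ b := by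
  simp [S, Srev, sgn_natCast, sgn_neg_natCast hb]

end DoubleSums

section BernoulliSum

variable {p : ℕ} [Fact p.Prime]

theorem one_div_pow_mem_pIntegers {k : ℕ} (hk : k ∈ Icc 1 (p - 1)) (a : ℕ) :
    1 / (k : ℚ) ^ a ∈ pIntegers p := by
  rw [mem_Icc] at hk
  rw [one_div, ← inv_pow]
  exact pow_mem (inv_mem_pIntegers_of_lt (by omega) (by omega)) a

theorem alternating_div_pow_mem_pIntegers {k : ℕ} (hk : k ∈ Icc 1 (p - 1)) (b : ℕ) :
    (-1) ^ k / (k : ℚ) ^ b ∈ pIntegers p := by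
  rw [div_eq_mul_one_div]
  exact mul_mem (pow_mem (neg_mem (one_mem _)) k) (one_div_pow_mem_pIntegers hk b)

theorem sum_one_div_pow_mem_pIntegers (a : ℕ) :
    ∑ k ∈ Icc 1 (p - 1), 1 / (k : ℚ) ^ a ∈ pIntegers p :=
  sum_mem fun _ hk => one_div_pow_mem_pIntegers hk a

theorem sum_alternating_div_pow_mem_pIntegers (b : ℕ) :
    ∑ k ∈ Icc 1 (p - 1), (-1) ^ k / (k : ℚ) ^ b ∈ pIntegers p :=
  sum_mem fun _ hk => alternating_div_pow_mem_pIntegers hk b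

theorem alternating_sum_pow_div_pow_sub_eulerZero_mem_pMultiples (hp2 : p ≠ 2) {b m n : ℕ}
    (hn : 0 < n) (h : m + (p - 1) = n + b) :
    ∑ k ∈ Icc 1 (p - 1), (-1) ^ k * ((k : ℚ) ^ m / (k : ℚ) ^ b) - eulerZero n
      ∈ pMultiples p := by
  have hp := (Fact.out : p.Prime).two_le
  have hrange : ∑ k ∈ range p, (-1) ^ k * (k : ℚ) ^ n
      = ∑ k ∈ Icc 1 (p - 1), (-1) ^ k * (k : ℚ) ^ n := by
    refine (sum_subset (fun k hk => ?_) fun k hk hk' => ?_).symm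
    · rw [mem_Icc] at hk
      exact mem_range.2 (by omega)
    · rw [mem_range] at hk
      rw [mem_Icc] at hk'
      obtain rfl : k = 0 := by omega
      simp [hn.ne']
  have h1 := alternating_sum_pow_sub_eulerZero_mem_pMultiples (p := p) hp2 n
  rw [hrange] at h1
  have h2 : ∑ k ∈ Icc 1 (p - 1), (-1) ^ k * ((k : ℚ) ^ n - (k : ℚ) ^ m / (k : ℚ) ^ b)
      ∈ pMultiples p := by
    refine sum_mem fun k hk => ?_
    rw [mem_Icc] at hk
    exact mul_mem_pMultiples (pow_mem (neg_mem (one_mem _)) k)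
      (one_div_pow_sub_pow_mem_pMultiples (by omega) (by omega) h)
  convert sub_mem h1 h2 using 1
  simp only [mul_sub, sum_sub_distrib]
  ring

theorem sum_Icc_pow_eq_sum_bernoulli {m : ℕ} (hm : 1 < m) (k : ℕ) :
    ∑ j ∈ Icc 1 (k - 1), (j : ℚ) ^ (m - 1)
      = ∑ i ∈ range m, bernoulli i * m.choose i / m * (k : ℚ) ^ (m - i) := by
  have hrange : ∑ j ∈ Icc 1 (k - 1), (j : ℚ) ^ (m - 1) = ∑ j ∈ range k, (j : ℚ) ^ (m - 1) := by
    refine sum_subset (fun j hj => ?_) fun j hj hj' => ?_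
    · rw [mem_Icc] at hj
      exact mem_range.2 (by omega)
    · rw [mem_range] at hj
      rw [mem_Icc] at hj'
      obtain rfl : j = 0 := by omega
      simp [show m - 1 ≠ 0 by omega]
  have hm' : ((m - 1 : ℕ) : ℚ) + 1 = m := by
    rw [← Nat.cast_add_one, Nat.sub_add_cancel hm.le]
  rw [hrange, sum_range_pow, hm', Nat.sub_add_cancel hm.le]
  exact sum_congr rfl fun i _ => by ring

theorem H_pos_neg_sub_sum_bernoulli_mem_pMultiples {a b : ℕ} (ha : 0 < a) (hb : 0 < b)
    (hpw : a + b + 2 ≤ p) :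
    H [(a : ℤ), -(b : ℤ)] (p - 1) - (∑ k ∈ range (p - a),
        (Nat.choose (p - a) k : ℚ) *
          (2 * (1 - 2 ^ (2 * p - a - b - k)) * bernoulli k * bernoulli (2 * p - a - b - k) /
            (((p : ℚ) - a) * ((2 * p - a - b - k : ℕ) : ℚ)))) ∈ pMultiples p := by
  set c : ℕ → ℚ := fun i => bernoulli i * (p - a).choose i / (p - a : ℕ) with hc
  have hpow : H [(a : ℤ), -(b : ℤ)] (p - 1) - ∑ k ∈ Icc 1 (p - 1), (-1) ^ k / (k : ℚ) ^ b *
      ∑ j ∈ Icc 1 (k - 1), (j : ℚ) ^ (p - a - 1) ∈ pMultiples p := by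
    rw [H_pos_neg a _ hb, ← sum_sub_distrib]
    refine sum_mem fun k hk => ?_
    rw [← mul_sub, ← sum_sub_distrib]
    refine mul_mem_pMultiples (alternating_div_pow_mem_pIntegers hk b) (sum_mem fun j hj => ?_)
    rw [mem_Icc] at hk hj
    rw [sub_mem_comm_iff]
    simpa using one_div_pow_sub_pow_mem_pMultiples (p := p) (k := j) (a := a) (m := 0)
      (n := p - a - 1) (by omega) (by omega) (by omega)
  have hswap : ∑ k ∈ Icc 1 (p - 1), (-1) ^ k / (k : ℚ) ^ b *
      ∑ j ∈ Icc 1 (k - 1), (j : ℚ) ^ (p - a - 1) = ∑ i ∈ range (p - a), c i *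
        ∑ k ∈ Icc 1 (p - 1), (-1) ^ k * ((k : ℚ) ^ (p - a - i) / (k : ℚ) ^ b) := by
    simp only [sum_Icc_pow_eq_sum_bernoulli (m := p - a) (by omega), mul_sum]
    rw [sum_comm]
    refine sum_congr rfl fun i _ => sum_congr rfl fun k _ => ?_
    ring
  have hterm : ∀ i ∈ range (p - a), (Nat.choose (p - a) i : ℚ) *
      (2 * (1 - 2 ^ (2 * p - a - b - i)) * bernoulli i * bernoulli (2 * p - a - b - i) /
        (((p : ℚ) - a) * ((2 * p - a - b - i : ℕ) : ℚ)))
      = c i * eulerZero (2 * p - a - b - i - 1) := by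
    intro i hi
    rw [mem_range] at hi
    rw [eulerZero, Nat.sub_add_cancel (by omega), hc, ← Nat.cast_sub (by omega : a ≤ p)]
    ring
  rw [sum_congr rfl hterm]
  rw [hswap] at hpow
  have heuler : ∑ i ∈ range (p - a), c i *
      (∑ k ∈ Icc 1 (p - 1), (-1) ^ k * ((k : ℚ) ^ (p - a - i) / (k : ℚ) ^ b)
        - eulerZero (2 * p - a - b - i - 1)) ∈ pMultiples p := by
    refine sum_mem fun i hi => ?_
    rw [mem_range] at hi
    refine mul_mem_pMultiples ?_ (alternating_sum_pow_div_pow_sub_eulerZero_mem_pMultiples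
      (by omega) (by omega) (by omega))
    rw [hc]
    refine mul_mem (mul_mem (bernoulli_mem_pIntegers (by omega)) (natCast_mem _ _)) ?_
    exact inv_mem_pIntegers_of_lt (by omega) (by omega)
  convert add_mem hpow heuler using 1
  simp only [mul_sub, sum_sub_distrib]
  ring

end BernoulliSum

/-- Even weight, depth two: congruence for `H(a,-b)` via a Bernoulli-number sum. -/
theorem depth_two_even_weight_mixed (a b : ℕ) (ha : 0 < a) (hb : 0 < b)
    (hab : Even (a + b)) (p : ℕ) (hp : p.Prime) (hpw : a + b + 2 ≤ p) :
    pcong p (S [(a : ℤ), -(b : ℤ)] (p - 1)) (H [(a : ℤ), -(b : ℤ)] (p - 1)) ∧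
    pcong p (H [(a : ℤ), -(b : ℤ)] (p - 1)) (-S [-(b : ℤ), (a : ℤ)] (p - 1)) ∧
    pcong p (-S [-(b : ℤ), (a : ℤ)] (p - 1)) (-H [-(b : ℤ), (a : ℤ)] (p - 1)) ∧
    pcong p (-H [-(b : ℤ), (a : ℤ)] (p - 1))
      (∑ k ∈ Finset.range (p - a),
        (Nat.choose (p - a) k : ℚ) *
          (2 * (1 - 2 ^ (2 * p - a - b - k)) * bernoulli k * bernoulli (2 * p - a - b - k) /
            (((p : ℚ) - a) * ((2 * p - a - b - k : ℕ) : ℚ)))) := by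
  have : Fact p.Prime := ⟨hp⟩
  have hp2 : p ≠ 2 := by omega
  have hdiag := sum_alternating_div_pow_mem_pMultiples (p := p) hp2 hab
  have hdiag₁ : ∑ k ∈ Icc 1 (p - 1), (-1) ^ k / (k : ℚ) ^ b * (1 / (k : ℚ) ^ a)
      ∈ pMultiples p := by
    convert hdiag using 2 with k
    rw [div_mul_div_comm, mul_one, ← pow_add, add_comm b a]
  have hdiag₂ : ∑ k ∈ Icc 1 (p - 1), 1 / (k : ℚ) ^ a * ((-1) ^ k / (k : ℚ) ^ b)
      ∈ pMultiples p := by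
    simpa only [mul_comm] using hdiag₁
  have hSH : S [(a : ℤ), -(b : ℤ)] (p - 1) - H [(a : ℤ), -(b : ℤ)] (p - 1)
      ∈ pMultiples p := by
    rw [S_pos_neg a _ hb, H_pos_neg a _ hb, sum_mul_sum_Icc_sub]
    exact hdiag₁
  have hHS : H [(a : ℤ), -(b : ℤ)] (p - 1) - -S [-(b : ℤ), (a : ℤ)] (p - 1)
      ∈ pMultiples p := by
    rw [sub_neg_eq_add, H_pos_neg a _ hb, S_neg_pos a _ hb, sum_mul_sum_Icc_add]
    rcases Nat.even_or_odd b with hb' | hb'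
    · rw [mul_comm]
      exact mul_mem_pMultiples (sum_one_div_pow_mem_pIntegers a)
        (sum_alternating_div_pow_mem_pMultiples hp2 hb')
    · exact mul_mem_pMultiples (sum_alternating_div_pow_mem_pIntegers b)
        (sum_one_div_pow_mem_pMultiples hp2 (by grind))
  have hSH' : -S [-(b : ℤ), (a : ℤ)] (p - 1) - -H [-(b : ℤ), (a : ℤ)] (p - 1)
      ∈ pMultiples p := by
    rw [← neg_sub', S_neg_pos a _ hb, H_neg_pos a _ hb, sum_mul_sum_Icc_sub]
    exact neg_mem hdiag₂
  simp only [pcong_iff]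
  refine ⟨hSH, hHS, hSH', ?_⟩
  have h := H_pos_neg_sub_sum_bernoulli_mem_pMultiples ha hb hpw
  convert sub_mem h (add_mem hHS hSH') using 1
  ring
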